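/- Let G be a GR space with involution ¬ and let A be its GR space reduct. If Φ : G → WK is a GR-morphism (i.e. Φ ∈ Hom_GR(A, 3)), then the map ¬Φ defined by (¬Φ)(a) = (Φ(¬a))' is again a GR-morphism from G to WK; moreover, the set Hom_GR(A, 3) equipped with the pointwise operations + and · of WK, the operation ¬Φ, and the constant morphisms with values 0 and 1, is an involutive bisemilattice. -/

import Mathlib

universe u v
/-- The axioms (I1)–(I8) of an involutive bisemilattice on a type `B` with
operations `·`, `+`, `'` and constants `0`, `1`. -/
structure IsInvolutiveBisemilattice {B : Type u} (mul add : B → B → B)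
    (inv : B → B) (zero one : B) : Prop where
  add_idem : ∀ x, add x x = x
  add_comm : ∀ x y, add x y = add y x
  add_assoc : ∀ x y z, add x (add y z) = add (add x y) z
  inv_inv : ∀ x, inv (inv x) = x
  mul_def : ∀ x y, mul x y = inv (add (inv x) (inv y))
  mul_add_absorb : ∀ x y, mul x (add (inv x) y) = mul x y
  zero_add : ∀ x, add zero x = x
  one_def : one = inv zero
/-- The three-element weak Kleene algebra: carrier `{0, α, 1}`. -/
inductive ThreeWK : Type
  | z : ThreeWK
  | a : ThreeWK
  | o : ThreeWK
deriving DecidableEq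

namespace ThreeWK

/-- The weak Kleene join `+`: `α` is absorbing, `0, 1` behave as in the
two-element lattice. -/
def add : ThreeWK → ThreeWK → ThreeWK
  | .a, _ => .a
  | _, .a => .a
  | .o, _ => .o
  | _, .o => .o
  | _, _ => .z

/-- The weak Kleene meet `·`: `α` is absorbing, `0, 1` behave as in the
two-element lattice. -/
def mul : ThreeWK → ThreeWK → ThreeWK
  | .a, _ => .a
  | _, .a => .a
  | .z, _ => .z
  | _, .z => .z
  | _, _ => .o

/-- The involution `'` of `WK`: `0' = 1`, `1' = 0`, `α' = α`. -/
def inv : ThreeWK → ThreeWK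
  | .z => .o
  | .o => .z
  | .a => .a

/-- The left-normal-band operation `a ∗ b = a + a·b` on `3`. -/
def star (x y : ThreeWK) : ThreeWK := x.add (x.mul y)

/-- The partial order `≤·` on `3`: `x ≤ y` iff `x·y = x` (so `α < 0 < 1`). -/
def le (x y : ThreeWK) : Prop := x.mul y = x

end ThreeWK

/-- The data of a GR space on a carrier `A`: a binary operation `∗`, a partial
order `≤`, constants `c₀, c₁, c_α` and a topology. -/
structure GRData (A : Type u) where
  star : A → A → A
  le : A → A → Prop
  c0 : A
  c1 : A
  ca : A
  top : TopologicalSpace A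

/-- The second order `⊑` of a GR space: `a ⊑ b` iff `a ∗ b ≤ b` and `b ∗ a = b`. -/
def GRData.sle {A : Type u} (d : GRData A) (x y : A) : Prop :=
  d.le (d.star x y) y ∧ d.star y x = y

/-- The three-element algebra `3` as a GR space: carrier `{0, α, 1}` with the
discrete topology, `a ∗ b = a + a·b`, the order `≤·`, and constants `0, 1, α`. -/
def WKData : GRData ThreeWK where
  star := ThreeWK.star
  le := ThreeWK.le
  c0 := ThreeWK.z
  c1 := ThreeWK.o
  ca := ThreeWK.a
  top := ⊥

/-- The axioms of a GR space: `⟨A, ∗⟩` is a left normal band, `≤` is a partial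
order compatible with `∗`, the constants behave as required, `∗` is continuous,
and the space is compact and totally order disconnected. -/
structure IsGR {A : Type u} (d : GRData A) : Prop where
  star_idem : ∀ x, d.star x x = x
  star_assoc : ∀ x y z, d.star (d.star x y) z = d.star x (d.star y z)
  left_normal : ∀ x y z, d.star x (d.star y z) = d.star x (d.star z y)
  le_refl : ∀ x, d.le x x
  le_antisymm : ∀ x y, d.le x y → d.le y x → x = y
  le_trans : ∀ x y z, d.le x y → d.le y z → d.le x z
  star_mono_right : ∀ x y z, d.le x y → d.le (d.star x z) (d.star y z)
  star_mono_left : ∀ x y z, d.le x y → d.le (d.star z x) (d.star z y)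
  star_le : ∀ x y, d.le (d.star x y) x
  star_ca : ∀ x, d.star x d.ca = d.ca
  ca_star : ∀ x, d.star d.ca x = d.ca
  star_c0 : ∀ x, d.star x d.c0 = x
  star_c1 : ∀ x, d.star x d.c1 = x
  c0_sle : ∀ x, d.sle d.c0 x
  le_c1 : ∀ x, d.le x d.c1
  ca_le : ∀ x, d.le d.ca x
  sle_ca : ∀ x, d.sle x d.ca
  sep : ∀ x, d.star d.c0 x = d.star d.c1 x → x = d.ca
  cont_star : @Continuous (A × A) A (@instTopologicalSpaceProd A A d.top d.top) d.top
      (fun p => d.star p.1 p.2)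
  compact : @CompactSpace A d.top
  le_closed : @IsClosed (A × A) (@instTopologicalSpaceProd A A d.top d.top)
      {p : A × A | d.le p.1 p.2}
  tod : ∀ x y : A, ¬ d.le x y → ∃ U : Set A, @IsClopen A d.top U ∧
      (∀ v w, d.le v w → w ∈ U → v ∈ U) ∧ y ∈ U ∧ x ∉ U

/-- A GR morphism: a continuous map preserving `∗`, the constants and the order. -/
structure GRHom {A : Type u} {B : Type v} (dA : GRData A) (dB : GRData B) where
  toFun : A → B
  cont : @Continuous A B dA.top dB.top toFun
  map_star : ∀ x y, toFun (dA.star x y) = dB.star (toFun x) (toFun y)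
  map_c0 : toFun dA.c0 = dB.c0
  map_c1 : toFun dA.c1 = dB.c1
  map_ca : toFun dA.ca = dB.ca
  mono : ∀ x y, dA.le x y → dB.le (toFun x) (toFun y)

/-- The axioms of a GR space with involution: a continuous involution `¬`
compatible with `∗`, antitone from `≤` to `⊑`, swapping `c₀` and `c₁` and fixing
`c_α`, such that moreover the hom-space `Hom_GR(A, 3)` with its natural involution
`(¬φ)(a) = (φ(¬a))'` satisfies `φ·(¬φ + ψ) = ψ·φ` pointwise, and there are
`φ₀, φ₁ ∈ Hom_GR(A, 3)` with `¬φ₀ = φ₁` and `φ + φ₀ = φ` for every `φ`. -/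
structure IsGRInv {A : Type u} (d : GRData A) (neg : A → A) : Prop where
  cont : @Continuous A A d.top d.top neg
  neg_neg : ∀ x, neg (neg x) = x
  neg_star : ∀ x y, neg (d.star x y) = d.star (neg x) (neg y)
  neg_anti : ∀ x y, d.le x y → d.sle (neg y) (neg x)
  neg_c0 : neg d.c0 = d.c1
  neg_c1 : neg d.c1 = d.c0
  neg_ca : neg d.ca = d.ca
  g5 : ∀ (φ ψ : GRHom d WKData) (x : A),
      ThreeWK.mul (φ.toFun x) (ThreeWK.add (ThreeWK.inv (φ.toFun (neg x))) (ψ.toFun x)) =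
        ThreeWK.mul (ψ.toFun x) (φ.toFun x)
  g6 : ∃ φ₀ φ₁ : GRHom d WKData,
      (∀ x, ThreeWK.inv (φ₀.toFun (neg x)) = φ₁.toFun x) ∧
      ∀ (φ : GRHom d WKData) (x : A), ThreeWK.add (φ.toFun x) (φ₀.toFun x) = φ.toFun x
theorem GRHom.ext_fun {A : Type u} {d : GRData A} {Φ Ψ : GRHom d WKData}
    (h : ∀ x, Φ.toFun x = Ψ.toFun x) : Φ = Ψ := by
  cases Φ; cases Ψ
  simp only [GRHom.mk.injEq]
  exact funext h

theorem cont_binop {A : Type u} [TopologicalSpace A] [TopologicalSpace ThreeWK]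
    [DiscreteTopology ThreeWK] (op : ThreeWK → ThreeWK → ThreeWK) (f g : A → ThreeWK)
    (hf : Continuous f) (hg : Continuous g) : Continuous (fun x => op (f x) (g x)) :=
  (continuous_of_discreteTopology (f := fun p : ThreeWK × ThreeWK => op p.1 p.2)).comp
    (hf.prodMk hg)

theorem wk_add_star (x y u v : ThreeWK) :
    (x.star y).add (u.star v) = (x.add u).star (y.add v) := by
  cases x <;> cases y <;> cases u <;> cases v <;> rfl

theorem wk_mul_star (x y u v : ThreeWK) :
    (x.star y).mul (u.star v) = (x.mul u).star (y.mul v) := by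
  cases x <;> cases y <;> cases u <;> cases v <;> rfl

theorem wk_inv_star (x y : ThreeWK) : (x.star y).inv = x.inv.star y.inv := by
  cases x <;> cases y <;> rfl

theorem wk_add_mono (x y u v : ThreeWK) (h : x.le y) (k : u.le v) :
    (x.add u).le (y.add v) := by
  cases x <;> cases y <;> cases u <;> cases v <;>
    simp_all [ThreeWK.le, ThreeWK.mul, ThreeWK.add]

theorem wk_mul_mono (x y u v : ThreeWK) (h : x.le y) (k : u.le v) :
    (x.mul u).le (y.mul v) := by
  cases x <;> cases y <;> cases u <;> cases v <;>
    simp_all [ThreeWK.le, ThreeWK.mul]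

theorem wk_inv_anti (x y : ThreeWK) (h : (x.star y).le y) (k : y.star x = y) :
    y.inv.le x.inv := by
  cases x <;> cases y <;>
    simp_all [ThreeWK.le, ThreeWK.mul, ThreeWK.add, ThreeWK.star, ThreeWK.inv]

/-- Pointwise sum of GR morphisms. -/
def homAdd {A : Type u} {d : GRData A} (Φ Ψ : GRHom d WKData) : GRHom d WKData where
  toFun x := (Φ.toFun x).add (Ψ.toFun x)
  cont := @cont_binop A d.top ⊥ (@DiscreteTopology.mk _ ⊥ rfl) _ _ _ Φ.cont Ψ.cont
  map_star x y := by rw [Φ.map_star, Ψ.map_star]; exact wk_add_star _ _ _ _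
  map_c0 := by rw [Φ.map_c0, Ψ.map_c0]; rfl
  map_c1 := by rw [Φ.map_c1, Ψ.map_c1]; rfl
  map_ca := by rw [Φ.map_ca, Ψ.map_ca]; rfl
  mono x y h := wk_add_mono _ _ _ _ (Φ.mono x y h) (Ψ.mono x y h)

/-- Pointwise product of GR morphisms. -/
def homMul {A : Type u} {d : GRData A} (Φ Ψ : GRHom d WKData) : GRHom d WKData where
  toFun x := (Φ.toFun x).mul (Ψ.toFun x)
  cont := @cont_binop A d.top ⊥ (@DiscreteTopology.mk _ ⊥ rfl) _ _ _ Φ.cont Ψ.cont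
  map_star x y := by rw [Φ.map_star, Ψ.map_star]; exact wk_mul_star _ _ _ _
  map_c0 := by rw [Φ.map_c0, Ψ.map_c0]; rfl
  map_c1 := by rw [Φ.map_c1, Ψ.map_c1]; rfl
  map_ca := by rw [Φ.map_ca, Ψ.map_ca]; rfl
  mono x y h := wk_mul_mono _ _ _ _ (Φ.mono x y h) (Ψ.mono x y h)

/-- The natural involution on GR morphisms. -/
def homNeg {A : Type u} {d : GRData A} {neg : A → A} (hI : IsGRInv d neg)
    (Φ : GRHom d WKData) : GRHom d WKData where
  toFun x := (Φ.toFun (neg x)).inv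
  cont := @cont_binop A d.top ⊥ (@DiscreteTopology.mk _ ⊥ rfl) (fun p _ => p.inv) _ _
    (@Continuous.comp _ _ _ d.top d.top ⊥ _ _ Φ.cont hI.cont) Φ.cont
  map_star x y := by rw [hI.neg_star, Φ.map_star]; exact wk_inv_star _ _
  map_c0 := by rw [hI.neg_c0, Φ.map_c1]; rfl
  map_c1 := by rw [hI.neg_c1, Φ.map_c0]; rfl
  map_ca := by rw [hI.neg_ca, Φ.map_ca]; rfl
  mono x y h := by
    obtain ⟨h1, h2⟩ := hI.neg_anti x y h
    have h3 := Φ.mono _ _ h1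
    have h4 := congrArg Φ.toFun h2
    rw [Φ.map_star] at h3 h4
    exact wk_inv_anti _ _ h3 h4

theorem wk_add_comm (x y : ThreeWK) : x.add y = y.add x := by
  cases x <;> cases y <;> rfl

theorem wk_mul_comm (x y : ThreeWK) : x.mul y = y.mul x := by
  cases x <;> cases y <;> rfl

/-- **Statement 12.** Let `G = (A, d, ¬)` be a GR space with involution. If
`Φ ∈ Hom_GR(A, 3)`, then `¬Φ`, defined by `(¬Φ)(a) = (Φ(¬a))'`, is again a GR
morphism from `G` to `WK`; moreover `Hom_GR(A, 3)`, equipped with the pointwise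
operations `+` and `·` of `WK`, the involution `Φ ↦ ¬Φ`, and suitable constants,
is an involutive bisemilattice. -/
theorem homGR_closed_under_involution_and_is_IBSL {A : Type u}
    (d : GRData A) (neg : A → A) (hGR : IsGR d) (hInv : IsGRInv d neg) :
    (∀ Φ : GRHom d WKData, ∃ Ψ : GRHom d WKData,
      ∀ x : A, Ψ.toFun x = ThreeWK.inv (Φ.toFun (neg x))) ∧
    ∃ (hadd hmul : GRHom d WKData → GRHom d WKData → GRHom d WKData)
      (hneg : GRHom d WKData → GRHom d WKData) (Φ₀ Φ₁ : GRHom d WKData),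
      (∀ Φ Ψ x, (hadd Φ Ψ).toFun x = ThreeWK.add (Φ.toFun x) (Ψ.toFun x)) ∧
      (∀ Φ Ψ x, (hmul Φ Ψ).toFun x = ThreeWK.mul (Φ.toFun x) (Ψ.toFun x)) ∧
      (∀ Φ x, (hneg Φ).toFun x = ThreeWK.inv (Φ.toFun (neg x))) ∧
      IsInvolutiveBisemilattice hmul hadd hneg Φ₀ Φ₁ := by
  refine ⟨fun Φ => ⟨homNeg hInv Φ, fun _ => rfl⟩, ?_⟩
  obtain ⟨φ₀, φ₁, h01, h0⟩ := hInv.g6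
  refine ⟨homAdd, homMul, homNeg hInv, φ₀, φ₁, fun _ _ _ => rfl, fun _ _ _ => rfl,
    fun _ _ => rfl, ?_⟩
  refine ⟨fun Φ => ?_, fun Φ Ψ => ?_, fun Φ Ψ Χ => ?_, fun Φ => ?_, fun Φ Ψ => ?_,
    fun Φ Ψ => ?_, fun Φ => ?_, ?_⟩ <;> refine GRHom.ext_fun fun x => ?_
  · change (Φ.toFun x).add (Φ.toFun x) = _
    cases Φ.toFun x <;> rfl
  · exact wk_add_comm _ _
  · change (Φ.toFun x).add ((Ψ.toFun x).add (Χ.toFun x)) =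
      ((Φ.toFun x).add (Ψ.toFun x)).add (Χ.toFun x)
    cases Φ.toFun x <;> cases Ψ.toFun x <;> cases Χ.toFun x <;> rfl
  · change ((Φ.toFun (neg (neg x))).inv).inv = _
    rw [hInv.neg_neg]
    cases Φ.toFun x <;> rfl
  · change (Φ.toFun x).mul (Ψ.toFun x) =
      (((Φ.toFun (neg (neg x))).inv).add ((Ψ.toFun (neg (neg x))).inv)).inv
    rw [hInv.neg_neg]
    cases Φ.toFun x <;> cases Ψ.toFun x <;> rfl
  · exact (hInv.g5 Φ Ψ x).trans (wk_mul_comm _ _)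
  · exact (wk_add_comm _ _).trans (h0 Φ x)
  · exact (h01 x).symm
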